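/- (Variable-exponent Grafakos–Kalton lemma.) Let $p(\cdot)\in\mathcal{P}_0$ with $0<p_-\le p_+<1$ and $p(\cdot)\in LH$. Then there is a constant $C$ such that for every countable collection of cubes $\{Q_k\}$ and nonnegative measurable functions $\{g_k\}$ with $\operatorname{supp}(g_k)\subset Q_k$, $$\Big\|\sum_k g_k\Big\|_{L^{p(\cdot)}}\le C\,\Big\|\sum_k\Big(\fint_{Q_k}g_k\,dy\Big)\chi_{Q_k}\Big\|_{L^{p(\cdot)}}.$$ -/

import Mathlib

open MeasureTheory ENNReal Filter Topology

noncomputable section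

/-- Euclidean space `ℝⁿ`. -/
abbrev Rn (n : ℕ) := EuclideanSpace ℝ (Fin n)

variable {n : ℕ}

/-- The closed axis-parallel cube with center `c` and half side length `r`. -/
def stdCube (c : Rn n) (r : ℝ) : Set (Rn n) := {y | ∀ i, |y i - c i| ≤ r}

/-- A cube with sides parallel to the coordinate axes. -/
def IsCube (Q : Set (Rn n)) : Prop := ∃ (c : Rn n) (r : ℝ), 0 < r ∧ Q = stdCube c r

/-- The average `⨍_Q f` of `f` over `Q`. -/
def cubeAvg (Q : Set (Rn n)) (f : Rn n → ℝ) : ℝ := (volume Q).toReal⁻¹ * ∫ y in Q, f y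

/-- The average `⨍_Q f` of a nonnegative function over `Q`, computed in `ℝ≥0∞`. -/
def cubeAvgE (Q : Set (Rn n)) (f : Rn n → ℝ) : ℝ≥0∞ :=
  (∫⁻ y in Q, ENNReal.ofReal (f y)) / volume Q

/-- The `L^q` average `(⨍_Q f^q)^{1/q}` of a nonnegative function over `Q`, in `ℝ≥0∞`. -/
def cubeAvgEq (Q : Set (Rn n)) (f : Rn n → ℝ) (q : ℝ) : ℝ≥0∞ :=
  ((∫⁻ y in Q, ENNReal.ofReal (f y) ^ q) / volume Q) ^ (1/q)

/-- A weight: a nonnegative locally integrable function, positive a.e. -/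
def IsWeight (w : Rn n → ℝ) : Prop :=
  LocallyIntegrable w volume ∧ (∀ x, 0 ≤ w x) ∧ ∀ᵐ x ∂(volume : Measure (Rn n)), 0 < w x

/-- The Muckenhoupt `A_1` condition with constant `C`. -/
def MuckA1With (w : Rn n → ℝ) (C : ℝ) : Prop :=
  ∀ Q : Set (Rn n), IsCube Q → ∀ᵐ x ∂(volume : Measure (Rn n)), x ∈ Q → cubeAvg Q w ≤ C * w x

/-- The Muckenhoupt `A_r` condition (`1 < r`) with constant `C`. -/
def MuckArWith (w : Rn n → ℝ) (r C : ℝ) : Prop :=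
  ∀ Q : Set (Rn n), IsCube Q →
    cubeAvg Q w * (cubeAvg Q fun x => w x ^ (1 - r / (r - 1))) ^ (r - 1) ≤ C

/-- The Muckenhoupt `A_r` condition, `r ≥ 1`. -/
def MuckA (w : Rn n → ℝ) (r : ℝ) : Prop :=
  (r = 1 ∧ ∃ C : ℝ, 0 < C ∧ MuckA1With w C) ∨
  (1 < r ∧ ∃ C : ℝ, 0 < C ∧ MuckArWith w r C)

/-- The class `A_∞ = ⋃_{r ≥ 1} A_r`. -/
def AInfty (w : Rn n → ℝ) : Prop := ∃ r : ℝ, 1 ≤ r ∧ MuckA w r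

/-- `r_w = inf { r ≥ 1 : w ∈ A_r }`. -/
def rIdx (w : Rn n → ℝ) : ℝ := sInf {r : ℝ | 1 ≤ r ∧ MuckA w r}

/-- The reverse Hölder condition `RH_s` with constant `C`. -/
def RHWith (w : Rn n → ℝ) (s C : ℝ) : Prop :=
  ∀ Q : Set (Rn n), IsCube Q → (cubeAvg Q fun x => w x ^ s) ^ (1/s) ≤ C * cubeAvg Q w

/-- The reverse Hölder class `RH_s`, `1 < s < ∞`. -/
def RH (w : Rn n → ℝ) (s : ℝ) : Prop := ∃ C : ℝ, 0 < C ∧ RHWith w s C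

/-- The reverse Hölder class `RH_∞`. -/
def RHInfty (w : Rn n → ℝ) : Prop :=
  ∃ C : ℝ, 0 < C ∧ ∀ Q : Set (Rn n), IsCube Q →
    ∀ᵐ x ∂(volume : Measure (Rn n)), x ∈ Q → w x ≤ C * cubeAvg Q w

/-- The weighted Lebesgue quasi-norm `‖f‖_{L^p(w)}`. -/
def weightedLp (p : ℝ) (w : Rn n → ℝ) (f : Rn n → ℝ) : ℝ≥0∞ :=
  (∫⁻ x, ENNReal.ofReal |f x| ^ p * ENNReal.ofReal (w x)) ^ (1/p)

/-- The weighted Lebesgue quasi-norm, for `ℝ≥0∞`-valued functions. -/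
def weightedLpE (p : ℝ) (w : Rn n → ℝ) (F : Rn n → ℝ≥0∞) : ℝ≥0∞ :=
  (∫⁻ x, F x ^ p * ENNReal.ofReal (w x)) ^ (1/p)

/-- The variable Lebesgue quasi-norm `‖F‖_{L^{p(·)}}`, for `ℝ≥0∞`-valued functions. -/
def varLpE (p : Rn n → ℝ) (F : Rn n → ℝ≥0∞) : ℝ≥0∞ :=
  sInf {lam : ℝ≥0∞ | 0 < lam ∧ ∫⁻ x, (F x / lam) ^ (p x) ≤ 1}

/-- The variable Lebesgue quasi-norm `‖f‖_{L^{p(·)}}`. -/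
def varLp (p : Rn n → ℝ) (f : Rn n → ℝ) : ℝ≥0∞ :=
  varLpE p fun x => ENNReal.ofReal |f x|

/-- An exponent function in `𝒫₀`: measurable with values in `(0,∞)`. -/
def ExponentP0 (p : Rn n → ℝ) : Prop := Measurable p ∧ ∀ x, 0 < p x

/-- Log-Hölder continuity, locally and at infinity. -/
def LogHolder (p : Rn n → ℝ) : Prop :=
  (∃ C₀ : ℝ, 0 < C₀ ∧ ∀ x y : Rn n, 0 < ‖x - y‖ → ‖x - y‖ < 1/2 →
      |p x - p y| ≤ C₀ / (-Real.log ‖x - y‖)) ∧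
  (∃ pinf Cinf : ℝ, 0 < Cinf ∧ ∀ x : Rn n, |p x - pinf| ≤ Cinf / Real.log (Real.exp 1 + ‖x‖))

/-- The partial derivative `∂_i f`. -/
def pderiv (i : Fin n) (f : Rn n → ℝ) : Rn n → ℝ :=
  fun x => fderiv ℝ f x (EuclideanSpace.single i 1)

/-- The higher-order partial derivative `∂^β f` for a multi-index `β`. -/
def multiDeriv (β : Fin n → ℕ) (f : Rn n → ℝ) : Rn n → ℝ :=
  (List.finRange n).foldr (fun i g => (pderiv i)^[β i] g) f

/-- An `(N,∞)` atom supported in the cube `Q`. -/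
def IsNAtom (N : ℕ) (a : Rn n → ℝ) (Q : Set (Rn n)) : Prop :=
  Measurable a ∧ (∀ x, |a x| ≤ 1) ∧ IsCube Q ∧ Function.support a ⊆ Q ∧
    ∀ β : Fin n → ℕ, (∑ i, β i) ≤ N → ∫ x, (∏ i, x i ^ β i) * a x = 0

/-- Membership in `𝒪_N`: a smooth compactly supported function with vanishing moments
up to order `N`. -/
def InON (N : ℕ) (f : Rn n → ℝ) : Prop :=
  ContDiff ℝ (⊤ : ℕ∞) f ∧ HasCompactSupport f ∧
    ∀ β : Fin n → ℕ, (∑ i, β i) ≤ N → ∫ x, (∏ i, x i ^ β i) * f x = 0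

/-- Tempered distributions on `ℝⁿ`. -/
abbrev TemperedDist (n : ℕ) := SchwartzMap (Rn n) ℝ →L[ℝ] ℝ

/-- The tempered distribution `u` is represented by the function `f`. -/
def Represents (u : TemperedDist n) (f : Rn n → ℝ) : Prop :=
  ∀ ψ : SchwartzMap (Rn n) ℝ, u ψ = ∫ x, f x * ψ x

/-- Membership in the class `𝒮_{N₀}`:
`∫ (1+|x|)^{N₀} (∑_{|β| ≤ N₀} |∂^β φ(x)|²) dx ≤ 1`. -/
def inSN (N₀ : ℕ) (φ : SchwartzMap (Rn n) ℝ) : Prop :=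
  ∫ x : Rn n, (1 + ‖x‖) ^ N₀ *
      ∑ β : Fin n → Fin (N₀ + 1),
        (if (∑ i, (β i : ℕ)) ≤ N₀ then
          (multiDeriv (fun i => (β i : ℕ)) (fun y => φ y) x) ^ 2 else 0) ≤ 1

/-- The grand maximal function `𝓜_{N₀} u (x) = sup_{φ ∈ 𝒮_{N₀}} sup_{t>0} |φ_t * u (x)|`,
where `φ_t * u (x) = u (y ↦ t^{-n} φ((x-y)/t))`. -/
def grandMax (N₀ : ℕ) (u : TemperedDist n) (x : Rn n) : ℝ≥0∞ :=
  sSup {r : ℝ≥0∞ | ∃ (φ ψ : SchwartzMap (Rn n) ℝ) (t : ℝ), 0 < t ∧ inSN N₀ φ ∧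
      (∀ y, ψ y = ((t ^ n)⁻¹ : ℝ) * φ (t⁻¹ • (x - y))) ∧ r = ENNReal.ofReal |u ψ|}

/-- The weighted Hardy space quasi-norm `‖u‖_{H^p(w)} = ‖𝓜_{N₀} u‖_{L^p(w)}`. -/
def hardyNorm (N₀ : ℕ) (p : ℝ) (w : Rn n → ℝ) (u : TemperedDist n) : ℝ≥0∞ :=
  weightedLpE p w (grandMax N₀ u)

/-- The variable Hardy space quasi-norm `‖u‖_{H^{p(·)}} = ‖𝓜_{N₀} u‖_{L^{p(·)}}`. -/
def hardyNormVar (N₀ : ℕ) (p : Rn n → ℝ) (u : TemperedDist n) : ℝ≥0∞ :=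
  varLpE p (grandMax N₀ u)

/-- The fractional maximal operator `M_γ` (the Hardy–Littlewood maximal operator if
`γ = 0`). -/
def fracMax (γ : ℝ) (f : Rn n → ℝ) (x : Rn n) : ℝ≥0∞ :=
  ⨆ (Q : Set (Rn n)) (_ : IsCube Q ∧ x ∈ Q),
    volume Q ^ (γ / (n : ℝ)) * ((∫⁻ y in Q, ENNReal.ofReal |f y|) / volume Q)

/-- `T` is bounded on (unweighted) `L²`. -/
def L2Bounded (T : (Rn n → ℝ) → Rn n → ℝ) : Prop :=
  ∃ A : ℝ, 0 < A ∧ ∀ f : Rn n → ℝ, Measurable f →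
    weightedLp 2 (fun _ => 1) (T f) ≤ ENNReal.ofReal A * weightedLp 2 (fun _ => 1) f

/-- The standard kernel size estimate `|K(x,y)| ≤ C|x-y|^{-n}`. -/
def CZKernelSize (K : Rn n → Rn n → ℝ) (C : ℝ) : Prop :=
  ∀ x y : Rn n, x ≠ y → |K x y| ≤ C * ‖x - y‖ ^ (-(n : ℝ))

/-- The standard kernel smoothness (Hölder) estimate of order `δ`. -/
def CZKernelSmooth (K : Rn n → Rn n → ℝ) (δ C : ℝ) : Prop :=
  ∀ x y h : Rn n, x ≠ y → ‖h‖ ≤ ‖x - y‖ / 2 →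
    |K x (y + h) - K x y| + |K (x + h) y - K x y| ≤ C * ‖h‖ ^ δ * ‖x - y‖ ^ (-(n : ℝ) - δ)

/-- A (non-convolution type) Calderón–Zygmund operator: bounded on `L²`, represented off
the support by a kernel `K` satisfying the standard estimates with exponent `δ`. -/
def CZOp (T : (Rn n → ℝ) → Rn n → ℝ) (K : Rn n → Rn n → ℝ) (δ : ℝ) : Prop :=
  L2Bounded T ∧ 0 < δ ∧ δ ≤ 1 ∧
  (∃ C : ℝ, 0 < C ∧ CZKernelSize K C ∧ CZKernelSmooth K δ C) ∧
  ∀ f : Rn n → ℝ, Measurable f → (∃ M : ℝ, ∀ x, |f x| ≤ M) → HasCompactSupport f →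
    ∀ x ∉ tsupport f, T f x = ∫ y, K x y * f y

/-- The higher-order smoothness condition on the kernel:
`|∂_y^β K(x,y+h) - ∂_y^β K(x,y)| ≤ C |h|^δ |x-y|^{-(n+m+δ)}` for all `|β| = m`. -/
def KernelHigherSmooth (K : Rn n → Rn n → ℝ) (δ : ℝ) (m : ℕ) (C : ℝ) : Prop :=
  (∀ x : Rn n, ContDiffOn ℝ m (fun z => K x z) {x}ᶜ) ∧
  ∀ β : Fin n → ℕ, (∑ i, β i) = m →
    ∀ x y h : Rn n, x ≠ y → ‖h‖ ≤ ‖x - y‖ / 2 →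
      |multiDeriv β (fun z => K x z) (y + h) - multiDeriv β (fun z => K x z) y|
        ≤ C * ‖h‖ ^ δ * ‖x - y‖ ^ (-((n : ℝ) + m + δ))

/-- `T` has `L` vanishing moments: `∫ x^β T a(x) dx = 0` for all `(L+1,∞)` atoms `a` and
all multi-indices `|β| ≤ L`.  (Vacuous if `L = -1`.) -/
def VanishingMoments (T : (Rn n → ℝ) → Rn n → ℝ) (L : ℤ) : Prop :=
  ∀ (a : Rn n → ℝ) (Q : Set (Rn n)), IsNAtom (L + 1).toNat a Q →
    ∀ β : Fin n → ℕ, (∑ i, (β i : ℤ)) ≤ L → ∫ x, (∏ i, x i ^ β i) * T a x = 0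

/-- Regularity of order `N+1` for a convolution kernel:
`|∂^α K(x)| ≤ A |x|^{-n-|α|}` for all `|α| ≤ N+1`. -/
def ConvKernelReg (K : Rn n → ℝ) (N : ℕ) : Prop :=
  ContDiffOn ℝ (N + 1 : ℕ) K {0}ᶜ ∧
  ∃ A : ℝ, 0 < A ∧ ∀ β : Fin n → ℕ, (∑ i, β i) ≤ N + 1 →
    ∀ x : Rn n, x ≠ 0 → |multiDeriv β K x| ≤ A * ‖x‖ ^ (-(n : ℝ) - (∑ i, β i))

/-- A Calderón–Zygmund singular integral operator of convolution type with regularity of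
order `N+1`: `T` is bounded on `L²` (equivalently, the kernel has bounded Fourier
transform), and `T f(x) = p.v. ∫ K(x-y) f(y) dy` for `f ∈ C_c^∞`. -/
def ConvCZO (T : (Rn n → ℝ) → Rn n → ℝ) (K : Rn n → ℝ) (N : ℕ) : Prop :=
  L2Bounded T ∧ ConvKernelReg K N ∧
  ∀ f : Rn n → ℝ, ContDiff ℝ (⊤ : ℕ∞) f → HasCompactSupport f → ∀ x : Rn n,
    Tendsto (fun ε : ℝ => ∫ y in {y : Rn n | ε < ‖x - y‖}, K (x - y) * f y)
      (𝓝[>] 0) (𝓝 (T f x))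

/-- The fractional integral operator `I_α`. -/
def fracInt (α : ℝ) (f : Rn n → ℝ) (x : Rn n) : ℝ :=
  ∫ y, f y * ‖x - y‖ ^ (α - (n : ℝ))

/-- The radial maximal function `M_φ g(x) = sup_{t>0} |φ_t * g(x)|` of a function `g`. -/
def MphiSup (φ : Rn n → ℝ) (g : Rn n → ℝ) (x : Rn n) : ℝ≥0∞ :=
  ⨆ (t : ℝ) (_ : 0 < t), ENNReal.ofReal |∫ y, (t ^ n)⁻¹ * φ (t⁻¹ • (x - y)) * g y|

lemma stdCube_eq_preimage (c : Rn n) {r : ℝ} (hr : 0 ≤ r) :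
    stdCube c r = WithLp.ofLp ⁻¹' Metric.closedBall (WithLp.ofLp c) r := by
  ext y
  simp [stdCube, dist_pi_le_iff hr, Real.dist_eq]

lemma measurableSet_stdCube (c : Rn n) {r : ℝ} (hr : 0 ≤ r) : MeasurableSet (stdCube c r) := by
  rw [stdCube_eq_preimage c hr]
  exact (PiLp.volume_preserving_ofLp (Fin n)).measurable Metric.isClosed_closedBall.measurableSet

lemma volume_stdCube (c : Rn n) {r : ℝ} (hr : 0 ≤ r) :
    volume (stdCube c r) = ENNReal.ofReal ((2 * r) ^ n) := by
  rw [stdCube_eq_preimage c hr, (PiLp.volume_preserving_ofLp (Fin n)).measure_preimage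
    Metric.isClosed_closedBall.measurableSet.nullMeasurableSet, Real.volume_pi_closedBall _ hr,
    Fintype.card_fin]

lemma center_mem_stdCube (c : Rn n) {r : ℝ} (hr : 0 ≤ r) : c ∈ stdCube c r := by
  intro i
  simpa using hr

lemma norm_sub_le_of_mem_stdCube {c x y : Rn n} {r s : ℝ} (hx : x ∈ stdCube c r)
    (hy : y ∈ stdCube c s) : ‖x - y‖ ≤ √n * (r + s) := by
  rcases Nat.eq_zero_or_pos n with rfl | hn
  · simp [Subsingleton.elim x y]
  have hc : ∀ i, |x i - y i| ≤ r + s := fun i => by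
    have h1 := hx i
    have h2 := hy i
    rw [abs_le] at *
    constructor <;> linarith [h1.1, h1.2, h2.1, h2.2]
  have hrs : 0 ≤ r + s := (abs_nonneg _).trans (hc ⟨0, hn⟩)
  rw [EuclideanSpace.norm_eq]
  refine Real.sqrt_le_iff.2 ⟨by positivity, ?_⟩
  rw [mul_pow, Real.sq_sqrt (Nat.cast_nonneg n)]
  refine (Finset.sum_le_card_nsmul Finset.univ _ ((r + s) ^ 2) fun i _ => ?_).trans (by simp)
  rw [Real.norm_eq_abs]
  exact pow_le_pow_left₀ (abs_nonneg _) (hc i) 2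

/-- If two cubes intersect and the side of the first is at most twice that of the second, then
the first is contained in the fivefold dilation of the second. -/
lemma stdCube_subset_of_inter {c d : Rn n} {r s : ℝ} (h : (stdCube c r ∩ stdCube d s).Nonempty)
    (hrs : r ≤ 2 * s) : stdCube c r ⊆ stdCube d (5 * s) := by
  obtain ⟨z, hz, hz'⟩ := h
  intro x hx i
  have h1 := hx i
  have h2 := hz i
  have h3 := hz' i
  rw [abs_le] at *
  constructor <;> linarith [h1.1, h1.2, h2.1, h2.2, h3.1, h3.2]

lemma LogHolder.continuous {p : Rn n → ℝ} (hp : LogHolder p) : Continuous p := by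
  obtain ⟨⟨C, hC, h⟩, -⟩ := hp
  rw [Metric.continuous_iff]
  intro x ε hε
  refine ⟨min (1 / 2) (Real.exp (-(C / ε))), by positivity, fun y hy => ?_⟩
  rw [dist_eq_norm] at hy
  rcases (norm_nonneg (y - x)).eq_or_lt with h0 | h0
  · rw [eq_comm, norm_eq_zero, sub_eq_zero] at h0
    simpa [h0] using hε
  rw [Real.dist_eq]
  refine (h y x h0 (hy.trans_le (min_le_left _ _))).trans_lt ?_
  have h1 : C / ε < -Real.log ‖y - x‖ := by
    have := Real.log_lt_log h0 (hy.trans_le (min_le_right _ _))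
    rw [Real.log_exp] at this
    linarith
  have h2 : 0 < C / ε := by positivity
  rw [div_lt_iff₀ (h2.trans h1)]
  rwa [div_lt_iff₀ hε, mul_comm] at h1

/-- A continuous function takes values in any closed set containing almost all of its values. -/
lemma forall_of_ae_mem_closed {p : Rn n → ℝ} (hp : Continuous p) {s : Set ℝ} (hs : IsClosed s)
    (h : ∀ᵐ x ∂(volume : Measure (Rn n)), p x ∈ s) (x : Rn n) : p x ∈ s := by
  have hd := Measure.dense_of_ae h
  have : closure {x | p x ∈ s} = {x | p x ∈ s} := (hs.preimage hp).closure_eq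
  have hx := hd x
  rwa [this] at hx

/-- On pairs of points at distance at most `D * 2 ^ (-j δ)`, a log-Hölder exponent oscillates by
at most `O(1 / j)`. -/
lemma LogHolder.exists_near_bound {p : Rn n → ℝ} (hp : LogHolder p) (hp01 : ∀ x, 0 < p x ∧ p x < 1)
    {D δ : ℝ} (hD : 0 < D) (hδ : 0 < δ) :
    ∃ B : ℝ, 0 ≤ B ∧ ∀ (j : ℝ) (x y : Rn n), 0 ≤ j → ‖x - y‖ ≤ D * 2 ^ (-(j * δ)) →
      j * (p x - p y) ≤ B := by
  obtain ⟨⟨C, hC, h⟩, -⟩ := hp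
  have hl : 0 < Real.log 2 := Real.log_pos (by norm_num)
  set J : ℝ := max (2 * Real.log D / (δ * Real.log 2)) (2 / δ) with hJ
  have hJ0 : 0 < J := lt_max_of_lt_right (by positivity)
  refine ⟨max J (2 * C / (δ * Real.log 2)), hJ0.le.trans (le_max_left _ _), ?_⟩
  intro j x y hj hxy
  rcases (norm_nonneg (x - y)).eq_or_lt with h0 | h0
  · rw [eq_comm, norm_eq_zero, sub_eq_zero] at h0
    simpa [h0] using Or.inl hJ0.le
  rcases le_or_gt j J with hjJ | hjJ
  · refine le_trans ?_ (le_max_left _ _)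
    have : p x - p y ≤ 1 := by linarith [(hp01 x).2, (hp01 y).1]
    nlinarith
  · refine le_trans ?_ (le_max_right _ _)
    have h1 : 2 * Real.log D ≤ j * (δ * Real.log 2) := by
      rw [← div_le_iff₀ (by positivity)]
      exact (le_max_left _ _).trans hjJ.le
    have h2 : 2 < j * δ := by
      rw [← div_lt_iff₀ hδ]
      exact (le_max_right _ _).trans_lt hjJ
    have h3 : Real.log ‖x - y‖ ≤ Real.log D - j * δ * Real.log 2 := by
      have := Real.log_le_log h0 hxy
      rw [Real.log_mul hD.ne' (by positivity), Real.log_rpow (by norm_num)] at this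
      linarith
    have h4 : j * (δ * Real.log 2) / 2 ≤ -Real.log ‖x - y‖ := by linarith
    have h5 : ‖x - y‖ < 1 / 2 := by
      rw [← Real.log_lt_log_iff h0 (by norm_num), one_div, Real.log_inv]
      nlinarith
    have h6 : 0 < j * (δ * Real.log 2) / 2 := by
      have : 0 < j := hJ0.trans hjJ
      positivity
    have h7 := (le_abs_self _).trans (h x y h0 h5)
    rw [le_div_iff₀ (h6.trans_le h4)] at h7
    rw [le_div_iff₀ (by positivity)]
    rcases le_or_gt (p x - p y) 0 with h8 | h8
    · have : j * (p x - p y) ≤ 0 := mul_nonpos_of_nonneg_of_nonpos hj h8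
      nlinarith [mul_pos hδ hl]
    · nlinarith

/-- The error term at level `j`, which is summable in `j` and integrable in `x`. -/
def decayErr (ε : ℝ) (j : ℤ) (x : Rn n) : ℝ :=
  2 ^ (-(ε * |(j : ℝ)|)) * (Real.exp 1 + ‖x‖) ^ (-(n + 1 : ℝ))

/-- The weight `2 ^ (j p(x))`, corrected by the error term at level `j`. -/
def levelWeight (p : Rn n → ℝ) (ε : ℝ) (j : ℤ) (x : Rn n) : ℝ :=
  2 ^ (j * p x) + decayErr ε j x

lemma decayErr_pos (ε : ℝ) (j : ℤ) (x : Rn n) : 0 < decayErr ε j x := by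
  unfold decayErr
  have : 0 < Real.exp 1 + ‖x‖ := by positivity
  positivity

lemma levelWeight_pos (p : Rn n → ℝ) (ε : ℝ) (j : ℤ) (x : Rn n) : 0 < levelWeight p ε j x :=
  add_pos (by positivity) (decayErr_pos ε j x)

/-- At levels `j < 0` and outside the region where the error term dominates, the exponent is
within `O(1 / |j|)` of its limit at infinity. -/
lemma LogHolder.exists_far_bound {p : Rn n → ℝ} (hp : LogHolder p) {ε : ℝ} (hε : 0 < ε) :
    ∃ B : ℝ, 0 ≤ B ∧ ∀ (j : ℤ) (x y : Rn n), j < 0 → decayErr ε j x ≤ 2 ^ (2 * ε * j) →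
      decayErr ε j y ≤ 2 ^ (2 * ε * j) → j * (p x - p y) ≤ B := by
  obtain ⟨-, q, C, hC, h⟩ := hp
  have hl : 0 < Real.log 2 := Real.log_pos (by norm_num)
  have key : ∀ (j : ℤ) (x : Rn n), j < 0 → decayErr ε j x ≤ 2 ^ (2 * ε * j) →
      |(j : ℝ)| * |p x - q| ≤ (n + 1) * C / (ε * Real.log 2) := by
    intro j x hj hx
    have hj' : (j : ℝ) < 0 := by exact_mod_cast hj
    have hL : 1 < Real.exp 1 + ‖x‖ := by
      linarith [norm_nonneg x, Real.add_one_lt_exp (one_ne_zero)]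
    have hL0 := Real.log_pos hL
    have h1 := Real.log_le_log (decayErr_pos ε j x) hx
    rw [decayErr, Real.log_mul (by positivity) (by positivity), Real.log_rpow (by norm_num),
      Real.log_rpow (by positivity), Real.log_rpow (by norm_num), abs_of_neg hj'] at h1
    have h2 : |(j : ℝ)| * (ε * Real.log 2) ≤ (n + 1) * Real.log (Real.exp 1 + ‖x‖) := by
      rw [abs_of_neg hj']
      nlinarith
    have h3 := h x
    rw [le_div_iff₀ hL0] at h3
    rw [le_div_iff₀ (by positivity)]
    calc |(j : ℝ)| * |p x - q| * (ε * Real.log 2)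
        = |(j : ℝ)| * (ε * Real.log 2) * |p x - q| := by ring
      _ ≤ (n + 1) * Real.log (Real.exp 1 + ‖x‖) * |p x - q| := by gcongr
      _ = (n + 1) * (|p x - q| * Real.log (Real.exp 1 + ‖x‖)) := by ring
      _ ≤ (n + 1) * C := by gcongr
  refine ⟨2 * ((n + 1) * C / (ε * Real.log 2)), by positivity, fun j x y hj hx hy => ?_⟩
  calc (j : ℝ) * (p x - p y) ≤ |(j : ℝ)| * |p x - p y| := by
        rw [← abs_mul]
        exact le_abs_self _
    _ ≤ |(j : ℝ)| * (|p x - q| + |p y - q|) := by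
        gcongr
        rw [abs_sub_comm (p y)]
        exact abs_sub_le _ _ _
    _ ≤ _ := by linarith [key j x hj hx, key j y hj hy]

/-- The analytic core: comparability of the weights at nearby points, and a good scale for
splitting `z ^ p(x) ≤ s ^ p(x) + s ^ (p(x) - 1) * z`. -/
lemma LogHolder.exists_levelWeight_bounds {p : Rn n → ℝ} (hp : LogHolder p) {a b : ℝ} (ha : 0 < a)
    (hb : b < 1) (hpab : ∀ x, a ≤ p x ∧ p x ≤ b) {D δ : ℝ} (hD : 0 < D) (hδ : 0 < δ) :
    ∃ ε C : ℝ, 0 < ε ∧ 1 ≤ C ∧ ∀ (j : ℤ) (x : Rn n),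
      (∀ y, (0 < j → ‖x - y‖ ≤ D * 2 ^ (-(j * δ))) →
        levelWeight p ε j x ≤ C * levelWeight p ε j y + 2 * decayErr ε j x) ∧
      ∃ s : ℝ, 0 < s ∧ s ^ p x ≤ levelWeight p ε j x ∧
        ∀ y, (0 < j → ‖x - y‖ ≤ D * 2 ^ (-(j * δ))) →
          s ^ (p x - 1) ≤ C * 2 ^ (-(j : ℝ)) * levelWeight p ε j y := by
  have hab : a ≤ b := (hpab 0).1.trans (hpab 0).2
  set ε := a * (1 - b) / 2 with hεdef
  have hε : 0 < ε := by
    have : 0 < 1 - b := by linarith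
    positivity
  have hεa : 2 * ε ≤ a := by
    rw [hεdef]
    nlinarith
  obtain ⟨B₀, hB₀, near⟩ := hp.exists_near_bound
    (fun x => ⟨ha.trans_le (hpab x).1, (hpab x).2.trans_lt hb⟩) hD hδ
  obtain ⟨B₁, hB₁, far⟩ := hp.exists_far_bound hε
  set B := max B₀ B₁
  have hB : 0 ≤ B := hB₀.trans (le_max_left _ _)
  have hC : (1 : ℝ) ≤ 2 ^ B := Real.one_le_rpow (by norm_num) hB
  have two1 : (1 : ℝ) ≤ 2 := by norm_num
  have cmp : ∀ (j : ℤ) (x y : Rn n), j * (p x - p y) ≤ B →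
      (2 : ℝ) ^ (j * p x) ≤ 2 ^ B * 2 ^ (j * p y) := by
    intro j x y h
    rw [← Real.rpow_add (by norm_num)]
    exact Real.rpow_le_rpow_of_exponent_le two1 (by linarith)
  have bad : ∀ (j : ℤ) (x y : Rn n), j < 0 → 2 ^ (2 * ε * j) < decayErr ε j x →
      (2 : ℝ) ^ (j * p y) ≤ decayErr ε j x := by
    intro j x y hj h
    have hj' : (j : ℝ) < 0 := by exact_mod_cast hj
    refine le_trans (Real.rpow_le_rpow_of_exponent_le two1 ?_) h.le
    nlinarith [(hpab y).1]
  have good : ∀ (j : ℤ) (x y : Rn n), (0 < j → ‖x - y‖ ≤ D * 2 ^ (-(j * δ))) →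
      (j < 0 → decayErr ε j x ≤ 2 ^ (2 * ε * j)) →
      (2 : ℝ) ^ (j * p x) ≤ 2 ^ B * levelWeight p ε j y := by
    intro j x y hxy hx
    have hw : (2 : ℝ) ^ B * 2 ^ (j * p y) ≤ 2 ^ B * levelWeight p ε j y := by
      gcongr
      exact le_add_of_nonneg_right (decayErr_pos ε j y).le
    rcases lt_trichotomy j 0 with hj | hj | hj
    · rcases le_or_gt (decayErr ε j y) (2 ^ (2 * ε * j)) with hy | hy
      · exact (cmp j x y ((far j x y hj (hx hj) hy).trans (le_max_right _ _))).trans hw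
      · have h1 : (2 : ℝ) ^ (j * p x) ≤ levelWeight p ε j y :=
          (bad j y x hj hy).trans (le_add_of_nonneg_left (by positivity))
        exact h1.trans (le_mul_of_one_le_left (levelWeight_pos p ε j y).le hC)
    · refine (cmp j x y ?_).trans hw
      simpa [hj] using hB
    · refine (cmp j x y ?_).trans hw
      exact (near j x y (by exact_mod_cast hj.le) (hxy hj)).trans (le_max_left _ _)
  refine ⟨ε, 2 ^ B, hε, hC, fun j x => ?_⟩
  by_cases hx : j < 0 → decayErr ε j x ≤ 2 ^ (2 * ε * j)
  · refine ⟨fun y hxy => ?_, 2 ^ (j : ℝ), by positivity, ?_, fun y hxy => ?_⟩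
    · have := good j x y hxy hx
      have h2 := decayErr_pos ε j x
      simp only [levelWeight] at this ⊢
      linarith
    · rw [← Real.rpow_mul (by norm_num)]
      exact le_add_of_nonneg_right (decayErr_pos ε j x).le
    · rw [← Real.rpow_mul (by norm_num), show (j : ℝ) * (p x - 1) = -j + j * p x by ring,
        Real.rpow_add (by norm_num), mul_comm (2 ^ B : ℝ), mul_assoc]
      gcongr
      exact good j x y hxy hx
  · push Not at hx
    obtain ⟨hj, hx⟩ := hx
    have hj' : (j : ℝ) < 0 := by exact_mod_cast hj
    have hpx : 0 < p x := ha.trans_le (hpab x).1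
    have hp1 : p x < 1 := (hpab x).2.trans_lt hb
    have he := decayErr_pos ε j x
    refine ⟨fun y _ => ?_, decayErr ε j x ^ (1 / p x), by positivity, ?_, fun y _ => ?_⟩
    · have h1 := bad j x x hj hx
      have h2 := levelWeight_pos p ε j y
      have h3 : 0 ≤ 2 ^ B * levelWeight p ε j y := by positivity
      rw [levelWeight]
      linarith
    · rw [← Real.rpow_mul he.le, one_div_mul_cancel hpx.ne', Real.rpow_one]
      exact le_add_of_nonneg_left (by positivity)
    · have hexp : 1 / p x * (p x - 1) ≤ 0 := by
        apply mul_nonpos_of_nonneg_of_nonpos (by positivity)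
        linarith
      have hlow : -(1 - b) ≤ 2 * ε * (1 / p x * (p x - 1)) := by
        have h1 : 1 / p x * (p x - 1) = 1 - 1 / p x := by field_simp
        have h2 : 1 / p x ≤ 1 / a := one_div_le_one_div_of_le ha (hpab x).1
        have h3 : 2 * ε * (1 / a) = 1 - b := by
          rw [hεdef]
          field_simp
        rw [h1]
        nlinarith
      calc (decayErr ε j x ^ (1 / p x)) ^ (p x - 1)
          = decayErr ε j x ^ (1 / p x * (p x - 1)) := by rw [← Real.rpow_mul he.le]
        _ ≤ (2 ^ (2 * ε * j)) ^ (1 / p x * (p x - 1)) :=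
            Real.rpow_le_rpow_of_nonpos (by positivity) hx.le hexp
        _ = 2 ^ (2 * ε * (1 / p x * (p x - 1)) * j) := by
            rw [← Real.rpow_mul (by norm_num)]
            ring_nf
        _ ≤ 2 ^ (-j + j * p y : ℝ) := by
            refine Real.rpow_le_rpow_of_exponent_le two1 ?_
            nlinarith [(hpab y).2]
        _ = 1 * 2 ^ (-j : ℝ) * 2 ^ (j * p y : ℝ) := by
            rw [Real.rpow_add (by norm_num), one_mul]
        _ ≤ 2 ^ B * 2 ^ (-(j : ℝ)) * levelWeight p ε j y := by
            gcongr
            exact le_add_of_nonneg_right (decayErr_pos ε j y).le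

lemma ENNReal.rpow_finsetSum_le {ι : Type*} (t : Finset ι) (f : ι → ℝ≥0∞) {p : ℝ} (hp : 0 < p)
    (hp1 : p ≤ 1) : (∑ i ∈ t, f i) ^ p ≤ ∑ i ∈ t, f i ^ p := by
  classical
  induction t using Finset.induction_on with
  | empty => simp [hp]
  | insert i t hi ih =>
    rw [Finset.sum_insert hi, Finset.sum_insert hi]
    exact (ENNReal.rpow_add_le_add_rpow _ _ hp.le hp1).trans (add_le_add_right ih _)

lemma ENNReal.rpow_le_rpow_add_rpow_sub_one_mul (z : ℝ≥0∞) {s p : ℝ} (hs : 0 < s) (hp : 0 < p)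
    (hp1 : p < 1) :
    z ^ p ≤ ENNReal.ofReal (s ^ p) + ENNReal.ofReal (s ^ (p - 1)) * z := by
  rcases le_total z (ENNReal.ofReal s) with h | h
  · refine le_add_right ?_
    rw [← ENNReal.ofReal_rpow_of_pos hs]
    exact ENNReal.rpow_le_rpow h hp.le
  · refine le_add_left ?_
    rcases eq_or_ne z ⊤ with rfl | hz
    · rw [ENNReal.mul_top]
      · exact le_top
      · rw [Ne, ENNReal.ofReal_eq_zero, not_le]
        positivity
    · have hz0 : z ≠ 0 := ((ENNReal.ofReal_pos.2 hs).trans_le h).ne'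
      calc z ^ p = z ^ (p - 1) * z ^ (1 : ℝ) := by
            rw [← ENNReal.rpow_add _ _ hz0 hz, sub_add_cancel]
        _ ≤ ENNReal.ofReal (s ^ (p - 1)) * z := by
            rw [ENNReal.rpow_one, ← ENNReal.ofReal_rpow_of_pos hs]
            refine mul_le_mul_left ?_ _
            rw [← neg_sub 1 p, ENNReal.rpow_neg, ENNReal.rpow_neg, ENNReal.inv_le_inv]
            exact ENNReal.rpow_le_rpow h (by linarith)

lemma iInf_mul_volume_le_setLIntegral (w : Rn n → ℝ≥0∞) {s t : Set (Rn n)} (hst : s ⊆ t)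
    (hs : MeasurableSet s) : (⨅ y ∈ t, w y) * volume s ≤ ∫⁻ x in s, w x := by
  rw [← setLIntegral_const]
  exact setLIntegral_mono' hs fun x hx => iInf₂_le x (hst hx)

/-- If each cube of a finite family has at least half of its volume in `Ω`, the integral over the
union of the cubes of an almost constant weight is controlled by the integral over `Ω`. -/
lemma setLIntegral_biUnion_stdCube_le (T : Finset ℕ) (c : ℕ → Rn n) (r : ℕ → ℝ)
    (hr : ∀ k, 0 < r k) {Ω : Set (Rn n)} (hΩ : MeasurableSet Ω)
    (hQ : ∀ k ∈ T, volume (stdCube (c k) (r k)) ≤ 2 * volume (stdCube (c k) (r k) ∩ Ω))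
    {w e : Rn n → ℝ≥0∞} (he : Measurable e) {C : ℝ≥0∞} (hC0 : C ≠ 0) (hC : C ≠ ⊤)
    (hcmp : ∀ k ∈ T, ∀ x ∈ stdCube (c k) (5 * r k), ∀ y ∈ stdCube (c k) (r k),
      w x ≤ C * w y + e x) :
    ∫⁻ x in ⋃ k ∈ T, stdCube (c k) (r k), w x
      ≤ C * (2 * 5 ^ n) * (∫⁻ x in Ω, w x) + ∫⁻ x, e x := by
  classical
  set Q : ℕ → Set (Rn n) := fun k => stdCube (c k) (r k) with hQdef
  set m : ℕ → ℝ≥0∞ := fun k => ⨅ y ∈ Q k, w y with hm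
  have hQm : ∀ k, MeasurableSet (Q k) := fun k => measurableSet_stdCube _ (hr k).le
  have hQ5m : ∀ k, MeasurableSet (stdCube (c k) (5 * r k)) := fun k =>
    measurableSet_stdCube _ (by linarith [hr k])
  obtain ⟨u, huT, hudis, hu⟩ := Vitali.exists_disjoint_subfamily_covering_enlargement Q (T : Set ℕ)
    r 2 (by norm_num) (fun k _ => (hr k).le) (∑ k ∈ T, r k)
    (fun k hk => Finset.single_le_sum (f := r) (fun i _ => (hr i).le) hk)
    (fun k _ => ⟨c k, center_mem_stdCube _ (hr k).le⟩)
  have hufin : u.Finite := T.finite_toSet.subset huT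
  lift u to Finset ℕ using hufin
  have hvol : ∀ k, volume (stdCube (c k) (5 * r k)) = 5 ^ n * volume (Q k) := by
    intro k
    rw [volume_stdCube _ (by linarith [hr k]), hQdef]
    simp only
    rw [volume_stdCube _ (hr k).le, show 2 * (5 * r k) = 5 * (2 * r k) by ring, mul_pow,
      ENNReal.ofReal_mul (by positivity), ENNReal.ofReal_pow (by norm_num)]
    norm_num
  have hpt : ∀ x ∈ ⋃ k ∈ T, Q k, w x ≤
      (∑ b ∈ u, (stdCube (c b) (5 * r b)).indicator (fun _ => C * m b) x) + e x := by
    intro x hx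
    simp only [Set.mem_iUnion] at hx
    obtain ⟨k, hk, hxk⟩ := hx
    obtain ⟨b, hb, hint, hle⟩ := hu k hk
    have hx5 : x ∈ stdCube (c b) (5 * r b) := stdCube_subset_of_inter hint hle hxk
    have h1 : w x ≤ C * m b + e x := by
      rw [← tsub_le_iff_right, mul_comm, ← ENNReal.div_le_iff hC0 hC]
      refine le_iInf₂ fun y hy => ?_
      rw [ENNReal.div_le_iff hC0 hC, mul_comm, tsub_le_iff_right]
      exact hcmp b (huT hb) x hx5 y hy
    refine h1.trans (add_le_add_left ?_ _)
    refine le_trans ?_ (Finset.single_le_sum (f := fun b =>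
      (stdCube (c b) (5 * r b)).indicator (fun _ => C * m b) x) (fun _ _ => zero_le) hb)
    simp [hx5]
  calc ∫⁻ x in ⋃ k ∈ T, Q k, w x
      ≤ ∫⁻ x in ⋃ k ∈ T, Q k,
          ((∑ b ∈ u, (stdCube (c b) (5 * r b)).indicator (fun _ => C * m b) x) + e x) :=
        setLIntegral_mono' (Finset.measurableSet_biUnion _ fun k _ => hQm k) hpt
    _ ≤ ∫⁻ x, ((∑ b ∈ u, (stdCube (c b) (5 * r b)).indicator (fun _ => C * m b) x) + e x) :=
        setLIntegral_le_lintegral _ _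
    _ = (∑ b ∈ u, C * m b * volume (stdCube (c b) (5 * r b))) + ∫⁻ x, e x := by
        rw [lintegral_add_right _ he, lintegral_finsetSum _ fun b _ =>
          measurable_const.indicator (hQ5m b)]
        simp_rw [lintegral_indicator_const (hQ5m _)]
    _ ≤ C * (2 * 5 ^ n) * (∑ b ∈ u, ∫⁻ x in Q b ∩ Ω, w x) + ∫⁻ x, e x := by
        refine add_le_add_left ?_ _
        rw [Finset.mul_sum]
        refine Finset.sum_le_sum fun b hb => ?_
        rw [hvol]
        calc C * m b * (5 ^ n * volume (Q b))
            ≤ C * m b * (5 ^ n * (2 * volume (Q b ∩ Ω))) := by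
              gcongr
              exact hQ b (huT hb)
          _ = C * (2 * 5 ^ n) * (m b * volume (Q b ∩ Ω)) := by ring
          _ ≤ _ := by
              gcongr
              exact iInf_mul_volume_le_setLIntegral w Set.inter_subset_left ((hQm b).inter hΩ)
    _ ≤ C * (2 * 5 ^ n) * (∫⁻ x in Ω, w x) + ∫⁻ x, e x := by
        gcongr
        rw [← lintegral_biUnion_finset]
        · exact lintegral_mono_set (Set.iUnion₂_subset fun _ _ => Set.inter_subset_right)
        · exact fun i hi k hk hik =>
            (hudis hi hk hik).mono Set.inter_subset_left Set.inter_subset_left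
        · exact fun b _ => (hQm b).inter hΩ

/-- The estimate at a single level: each cube `Q k` has half of its volume outside `Ω`, and
`F ≤ τ` there. -/
lemma lintegral_rpow_sum_le_setLIntegral (T : Finset ℕ) {Q : ℕ → Set (Rn n)}
    (hQm : ∀ k, MeasurableSet (Q k)) (hQ0 : ∀ k, volume (Q k) ≠ 0) (hQt : ∀ k, volume (Q k) ≠ ⊤)
    {f : ℕ → Rn n → ℝ≥0∞} (hf : ∀ k, Measurable (f k)) (hfQ : ∀ k, ∀ x ∉ Q k, f k x = 0)
    {F w : Rn n → ℝ≥0∞} (hw : Measurable w) {Ω : Set (Rn n)} (hΩ : MeasurableSet Ω)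
    {p : Rn n → ℝ} (hp : ∀ x, 0 < p x ∧ p x < 1) {C τ : ℝ} (hτ : 0 < τ)
    (hF : ∀ x ∉ Ω, F x ≤ ENNReal.ofReal τ)
    (haF : ∀ x, ∑ k ∈ T, ((∫⁻ y in Q k, f k y) / volume (Q k)) *
      (Q k).indicator (fun _ => (1 : ℝ≥0∞)) x ≤ F x)
    (hhalf : ∀ k ∈ T, volume (Q k) ≤ 2 * volume (Q k \ Ω))
    (hsplit : ∀ x, ∃ s : ℝ, 0 < s ∧ ENNReal.ofReal (s ^ p x) ≤ w x ∧
      ∀ k ∈ T, x ∈ Q k → ∀ y ∈ Q k,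
        ENNReal.ofReal (s ^ (p x - 1)) ≤ ENNReal.ofReal (C * τ⁻¹) * w y) :
    ∫⁻ x, (∑ k ∈ T, f k x) ^ p x ≤ (1 + 2 * ENNReal.ofReal C) * ∫⁻ x in ⋃ k ∈ T, Q k, w x := by
  set U := ⋃ k ∈ T, Q k with hU
  have hUm : MeasurableSet U := Finset.measurableSet_biUnion _ fun k _ => hQm k
  set m : ℕ → ℝ≥0∞ := fun k => ⨅ y ∈ Q k, w y with hm
  set a : ℕ → ℝ≥0∞ := fun k => (∫⁻ y in Q k, f k y) / volume (Q k) with ha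
  set A := ENNReal.ofReal (C * τ⁻¹) with hA
  have hAtop : A ≠ ⊤ := ENNReal.ofReal_ne_top
  have hτ' : A * ENNReal.ofReal τ = ENNReal.ofReal C := by
    rw [hA, ENNReal.ofReal_mul' (by positivity), mul_assoc, ← ENNReal.ofReal_mul (by positivity),
      inv_mul_cancel₀ hτ.ne', ENNReal.ofReal_one, mul_one]
  have hpt : ∀ x, (∑ k ∈ T, f k x) ^ p x ≤ U.indicator w x + ∑ k ∈ T, A * m k * f k x := by
    intro x
    by_cases hx : x ∈ U
    · obtain ⟨s, hs, hsw, hsy⟩ := hsplit x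
      refine (ENNReal.rpow_le_rpow_add_rpow_sub_one_mul _ hs (hp x).1 (hp x).2).trans ?_
      rw [Set.indicator_of_mem hx, Finset.mul_sum]
      refine add_le_add hsw (Finset.sum_le_sum fun k hk => ?_)
      by_cases hxk : x ∈ Q k
      · gcongr
        rcases eq_or_ne A 0 with h0 | h0
        · have := hsy k hk hxk x hxk
          rw [h0, zero_mul] at this ⊢
          exact this
        · rw [mul_comm, ← ENNReal.div_le_iff h0 hAtop]
          refine le_iInf₂ fun y hy => ?_
          rw [ENNReal.div_le_iff h0 hAtop, mul_comm]
          exact hsy k hk hxk y hy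
      · simp [hfQ k x hxk]
    · have : ∑ k ∈ T, f k x = 0 := Finset.sum_eq_zero fun k hk =>
        hfQ k x fun h => hx (Set.mem_biUnion hk h)
      rw [this, ENNReal.zero_rpow_of_pos (hp x).1]
      exact zero_le
  have hint : ∀ k, ∫⁻ x, f k x = a k * volume (Q k) := by
    intro k
    rw [ha]
    simp only
    rw [ENNReal.div_mul_cancel (hQ0 k) (hQt k), ← lintegral_indicator (hQm k)]
    congr 1
    ext x
    by_cases hx : x ∈ Q k <;> simp [hx, hfQ k x]
  have hsum : ∑ k ∈ T, m k * a k * volume (Q k \ Ω) ≤ ENNReal.ofReal τ * ∫⁻ x in U, w x := by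
    calc ∑ k ∈ T, m k * a k * volume (Q k \ Ω)
        ≤ ∑ k ∈ T, ∫⁻ x in U \ Ω, w x * (a k * (Q k).indicator (fun _ => (1 : ℝ≥0∞)) x) := by
          refine Finset.sum_le_sum fun k hk => ?_
          calc m k * a k * volume (Q k \ Ω) = a k * (m k * volume (Q k \ Ω)) := by ring
            _ ≤ a k * ∫⁻ x in Q k \ Ω, w x := by
                gcongr
                exact iInf_mul_volume_le_setLIntegral w Set.sdiff_subset ((hQm k).diff hΩ)
            _ = ∫⁻ x in Q k \ Ω, w x * (a k * (Q k).indicator (fun _ => (1 : ℝ≥0∞)) x) := by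
                rw [← lintegral_const_mul _ hw]
                refine setLIntegral_congr_fun ((hQm k).diff hΩ) fun x hx => ?_
                simp [hx.1, mul_comm]
            _ ≤ _ := lintegral_mono_set (Set.sdiff_subset_sdiff_left
                (Set.subset_biUnion_of_mem (u := Q) hk))
      _ = ∫⁻ x in U \ Ω, w x * ∑ k ∈ T, a k * (Q k).indicator (fun _ => (1 : ℝ≥0∞)) x := by
          simp_rw [Finset.mul_sum]
          rw [lintegral_finsetSum]
          exact fun k _ => hw.mul ((measurable_const.indicator (hQm k)).const_mul _)
      _ ≤ ∫⁻ x in U \ Ω, ENNReal.ofReal τ * w x := by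
          refine setLIntegral_mono' (hUm.diff hΩ) fun x hx => ?_
          rw [mul_comm]
          gcongr
          exact (haF x).trans (hF x hx.2)
      _ ≤ ENNReal.ofReal τ * ∫⁻ x in U, w x := by
          rw [lintegral_const_mul _ hw]
          gcongr
          exact Set.sdiff_subset
  calc ∫⁻ x, (∑ k ∈ T, f k x) ^ p x
      ≤ ∫⁻ x, (U.indicator w x + ∑ k ∈ T, A * m k * f k x) := lintegral_mono hpt
    _ = (∫⁻ x in U, w x) + ∑ k ∈ T, A * m k * (a k * volume (Q k)) := by
        rw [lintegral_add_left (hw.indicator hUm), lintegral_indicator hUm,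
          lintegral_finsetSum _ fun k _ => (hf k).const_mul _]
        simp_rw [lintegral_const_mul _ (hf _), hint]
    _ ≤ (∫⁻ x in U, w x) + 2 * A * ∑ k ∈ T, m k * a k * volume (Q k \ Ω) := by
        refine add_le_add_right ?_ _
        rw [Finset.mul_sum]
        refine Finset.sum_le_sum fun k hk => ?_
        calc A * m k * (a k * volume (Q k)) ≤ A * m k * (a k * (2 * volume (Q k \ Ω))) := by
              gcongr
              exact hhalf k hk
          _ = _ := by ring
    _ ≤ (∫⁻ x in U, w x) + 2 * A * (ENNReal.ofReal τ * ∫⁻ x in U, w x) := by gcongr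
    _ = _ := by
        rw [← hτ']
        ring

lemma tsum_ofReal_two_rpow_neg_abs_ne_top {ε : ℝ} (hε : 0 < ε) :
    ∑' j : ℤ, ENNReal.ofReal (2 ^ (-(ε * |(j : ℝ)|))) ≠ ⊤ := by
  have h : Summable fun k : ℕ => (2 : ℝ) ^ (-(ε * (k : ℝ))) := by
    have : ∀ k : ℕ, (2 : ℝ) ^ (-(ε * (k : ℝ))) = ((2 : ℝ) ^ (-ε)) ^ k := fun k => by
      rw [← Real.rpow_natCast, ← Real.rpow_mul (by norm_num), neg_mul]
    simp_rw [this]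
    exact summable_geometric_of_lt_one (by positivity)
      (Real.rpow_lt_one_of_one_lt_of_neg (by norm_num) (by linarith))
  exact Summable.tsum_ofReal_ne_top (Summable.of_nat_of_neg (by simpa using h) (by simpa using h))

lemma ofReal_two_rpow_mul_le_rpow {z : ℝ≥0∞} {j p : ℝ} (hp : 0 < p)
    (h : ENNReal.ofReal (2 ^ j) < z) : ENNReal.ofReal (2 ^ (j * p)) ≤ z ^ p := by
  rw [Real.rpow_mul (by norm_num), ← ENNReal.ofReal_rpow_of_pos (by positivity)]
  exact ENNReal.rpow_le_rpow h.le hp.le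

/-- A geometric sum over the dyadic levels below `z` is controlled by its largest term. -/
lemma sum_two_rpow_mul_le (J : Finset ℤ) {z : ℝ≥0∞} {a p : ℝ} (ha : 0 < a) (hap : a ≤ p)
    (hp1 : p ≤ 1) (hJ : ∀ j ∈ J, ENNReal.ofReal (2 ^ ((j - 1 : ℤ) : ℝ)) < z) :
    ∑ j ∈ J, ENNReal.ofReal (2 ^ (j * p)) ≤
      2 * (∑' j : ℤ, ENNReal.ofReal (2 ^ (-(a * |(j : ℝ)|)))) * z ^ p := by
  rcases J.eq_empty_or_nonempty with rfl | hne
  · simp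
  set i := J.max' hne
  have hi : ENNReal.ofReal (2 ^ (i * p)) ≤ 2 * z ^ p := by
    have h1 := ofReal_two_rpow_mul_le_rpow (ha.trans_le hap) (hJ i (J.max'_mem hne))
    calc ENNReal.ofReal (2 ^ (i * p))
        ≤ ENNReal.ofReal (2 * 2 ^ (((i - 1 : ℤ) : ℝ) * p)) := by
          refine ENNReal.ofReal_le_ofReal ?_
          have : (i : ℝ) * p ≤ 1 + ((i - 1 : ℤ) : ℝ) * p := by
            push_cast
            linarith
          refine (Real.rpow_le_rpow_of_exponent_le (by norm_num) this).trans_eq ?_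
          rw [Real.rpow_add (by norm_num), Real.rpow_one]
      _ = 2 * ENNReal.ofReal (2 ^ (((i - 1 : ℤ) : ℝ) * p)) := by
          rw [ENNReal.ofReal_mul (by norm_num)]
          norm_num
      _ ≤ 2 * z ^ p := by gcongr
  calc ∑ j ∈ J, ENNReal.ofReal (2 ^ (j * p))
      ≤ ∑ j ∈ J, ENNReal.ofReal (2 ^ (i * p)) *
          ENNReal.ofReal (2 ^ (-(a * |((i - j : ℤ) : ℝ)|))) := by
        refine Finset.sum_le_sum fun j hj => ?_
        rw [← ENNReal.ofReal_mul (by positivity), ← Real.rpow_add (by norm_num)]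
        refine ENNReal.ofReal_le_ofReal (Real.rpow_le_rpow_of_exponent_le (by norm_num) ?_)
        have h1 : (j : ℝ) ≤ i := by exact_mod_cast J.le_max' j hj
        push_cast
        rw [abs_of_nonneg (by linarith)]
        nlinarith
    _ ≤ ENNReal.ofReal (2 ^ (i * p)) * ∑' j : ℤ, ENNReal.ofReal (2 ^ (-(a * |(j : ℝ)|))) := by
        rw [← Finset.mul_sum]
        refine mul_le_mul_right ?_ _
        refine (ENNReal.sum_le_tsum J).trans_eq ?_
        exact (Equiv.subLeft i).tsum_eq fun j : ℤ => ENNReal.ofReal (2 ^ (-(a * |(j : ℝ)|)))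
    _ ≤ _ := by
        refine (mul_le_mul_left hi _).trans_eq ?_
        ring

lemma measurable_decayErr (ε : ℝ) (j : ℤ) : Measurable (decayErr (n := n) ε j) := by
  unfold decayErr
  fun_prop

lemma measurable_levelWeight {p : Rn n → ℝ} (hp : Measurable p) (ε : ℝ) (j : ℤ) :
    Measurable (levelWeight p ε j) := by
  have := measurable_decayErr (n := n) ε j
  unfold levelWeight
  fun_prop

lemma exists_sum_lintegral_decayErr_le {ε : ℝ} (hε : 0 < ε) :
    ∃ K : ℝ≥0∞, K ≠ ⊤ ∧ ∀ J : Finset ℤ,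
      ∑ j ∈ J, ∫⁻ x : Rn n, ENNReal.ofReal (decayErr ε j x) ≤ K := by
  set H : ℝ≥0∞ := ∫⁻ x : Rn n, ENNReal.ofReal ((Real.exp 1 + ‖x‖) ^ (-(n + 1 : ℝ))) with hH
  have hHtop : H ≠ ⊤ := by
    have hint : Integrable (fun x : Rn n => (1 + ‖x‖) ^ (-(n + 1 : ℝ))) volume :=
      integrable_one_add_norm (by simp)
    refine ((lintegral_mono fun x => ENNReal.ofReal_le_ofReal ?_).trans_lt
      hint.lintegral_lt_top).ne
    exact Real.rpow_le_rpow_of_nonpos (by positivity)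
      (by linarith [Real.add_one_lt_exp (one_ne_zero)]) (by linarith [n.cast_nonneg (α := ℝ)])
  refine ⟨(∑' j : ℤ, ENNReal.ofReal (2 ^ (-(ε * |(j : ℝ)|)))) * H,
    ENNReal.mul_ne_top (tsum_ofReal_two_rpow_neg_abs_ne_top hε) hHtop, fun J => ?_⟩
  calc ∑ j ∈ J, ∫⁻ x : Rn n, ENNReal.ofReal (decayErr ε j x)
      = (∑ j ∈ J, ENNReal.ofReal (2 ^ (-(ε * |(j : ℝ)|)))) * H := by
        rw [Finset.sum_mul]
        refine Finset.sum_congr rfl fun j _ => ?_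
        rw [hH, ← lintegral_const_mul]
        · refine lintegral_congr fun x => ?_
          rw [decayErr, ENNReal.ofReal_mul (by positivity)]
        · fun_prop
    _ ≤ _ := mul_le_mul_left (ENNReal.sum_le_tsum J) _

/-- The set where `F` exceeds `2 ^ j`. -/
def superlevel (F : Rn n → ℝ≥0∞) (j : ℤ) : Set (Rn n) := {x | ENNReal.ofReal (2 ^ (j : ℝ)) < F x}

lemma measurableSet_superlevel {F : Rn n → ℝ≥0∞} (hF : Measurable F) (j : ℤ) :
    MeasurableSet (superlevel F j) := measurableSet_lt measurable_const hF

lemma volume_superlevel_le {p : Rn n → ℝ} {a : ℝ} (ha : 0 < a) (hap : ∀ x, a ≤ p x)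
    {F : Rn n → ℝ≥0∞} (hF : Measurable F) (hFp : ∫⁻ x, F x ^ p x ≤ 1) {j : ℤ} (hj : 0 ≤ j) :
    volume (superlevel F j) ≤ ENNReal.ofReal (2 ^ (-(j * a))) := by
  have h : ENNReal.ofReal (2 ^ (j * a)) * volume (superlevel F j) ≤ 1 := by
    rw [← setLIntegral_const]
    refine (setLIntegral_mono' (measurableSet_superlevel hF j) fun x hx => ?_).trans
      ((setLIntegral_le_lintegral _ _).trans hFp)
    refine le_trans (ENNReal.ofReal_le_ofReal ?_)
      (ofReal_two_rpow_mul_le_rpow (ha.trans_le (hap x)) hx)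
    refine Real.rpow_le_rpow_of_exponent_le (by norm_num) ?_
    have : (0 : ℝ) ≤ j := by exact_mod_cast hj
    gcongr
    exact hap x
  rw [Real.rpow_neg (by norm_num), ENNReal.ofReal_inv_of_pos (by positivity)]
  exact ENNReal.le_inv_iff_mul_le.2 (by rwa [mul_comm])

/-- Every set of finite positive measure on which `F` is bounded below has a critical level. -/
lemma exists_critical_level {p : Rn n → ℝ} {a : ℝ} (ha : 0 < a) (hap : ∀ x, a ≤ p x)
    {F : Rn n → ℝ≥0∞} (hF : Measurable F) (hFp : ∫⁻ x, F x ^ p x ≤ 1) {Q : Set (Rn n)}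
    (hQ0 : volume Q ≠ 0) (hQt : volume Q ≠ ⊤) {v : ℝ≥0∞} (hv : v ≠ 0)
    (hvF : ∀ x ∈ Q, v ≤ F x) :
    ∃ j : ℤ, volume Q ≤ 2 * volume (Q \ superlevel F j) ∧
      volume Q ≤ 2 * volume (Q ∩ superlevel F (j - 1)) := by
  have hsplit : ∀ j, volume Q = volume (Q ∩ superlevel F j) + volume (Q \ superlevel F j) :=
    fun j => (measure_inter_add_sdiff Q (measurableSet_superlevel hF j)).symm
  have hgeom : ∀ c : ℝ, 0 < c → Tendsto (fun k : ℕ => ENNReal.ofReal (2 ^ (-(k * c)))) atTop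
      (𝓝 0) := by
    intro c hc
    rw [← ENNReal.ofReal_zero]
    refine ENNReal.tendsto_ofReal ?_
    have : ∀ k : ℕ, (2 : ℝ) ^ (-(k * c)) = ((2 : ℝ) ^ (-c)) ^ k := fun k => by
      rw [← Real.rpow_natCast, ← Real.rpow_mul (by norm_num)]
      ring_nf
    simp_rw [this]
    exact tendsto_pow_atTop_nhds_zero_of_lt_one (by positivity)
      (Real.rpow_lt_one_of_one_lt_of_neg (by norm_num) (by linarith))
  obtain ⟨j, hj, hmin⟩ := Int.exists_least_of_bdd
    (P := fun j => volume Q ≤ 2 * volume (Q \ superlevel F j)) (by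
      obtain ⟨k, hk⟩ := ((hgeom 1 one_pos).eventually_lt_const (pos_iff_ne_zero.2 hv)).exists
      refine ⟨-k, fun z hz => ?_⟩
      by_contra! hzk
      have hempty : Q \ superlevel F z = ∅ := by
        rw [Set.sdiff_eq_empty]
        intro x hx
        refine lt_of_le_of_lt (ENNReal.ofReal_le_ofReal ?_) (hk.trans_le (hvF x hx))
        refine Real.rpow_le_rpow_of_exponent_le (by norm_num) ?_
        rw [mul_one]
        exact_mod_cast hzk.le
      rw [hempty, measure_empty, mul_zero] at hz
      exact hQ0 (le_antisymm hz zero_le)) (by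
      obtain ⟨k, hk⟩ := ((hgeom a ha).eventually_lt_const
        (ENNReal.half_pos hQ0)).exists
      refine ⟨k, ?_⟩
      have h1 : volume (Q ∩ superlevel F k) ≤ volume Q / 2 :=
        (measure_mono Set.inter_subset_right).trans
          ((volume_superlevel_le ha hap hF hFp (Int.natCast_nonneg k)).trans (by
            simpa using hk.le))
      have h2 : volume Q / 2 + volume Q / 2 ≤ volume Q / 2 + volume (Q \ superlevel F k) := by
        rw [ENNReal.add_halves]
        nth_rewrite 1 [hsplit k]
        exact add_le_add_left h1 _
      have h3 := ENNReal.le_of_add_le_add_left (ENNReal.div_ne_top hQt (by norm_num)) h2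
      rwa [ENNReal.div_le_iff (by norm_num) (by norm_num), mul_comm] at h3)
  refine ⟨j, hj, ?_⟩
  have h1 : 2 * volume (Q \ superlevel F (j - 1)) < volume Q := by
    by_contra! h
    have := hmin _ h
    lia
  by_contra! h2
  have h3 := ENNReal.add_lt_add h1 h2
  rw [← mul_add, add_comm (volume (Q \ _)), ← hsplit, two_mul] at h3
  exact lt_irrefl _ h3

/-- A cube with half of its volume in the set `{F > 2 ^ (j - 1)}` is small when `j` is large. -/
lemma norm_sub_le_of_critical {p : Rn n → ℝ} {a : ℝ} (ha : 0 < a) (ha1 : a ≤ 1)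
    (hap : ∀ x, a ≤ p x) {F : Rn n → ℝ≥0∞} (hF : Measurable F) (hFp : ∫⁻ x, F x ^ p x ≤ 1)
    {c : Rn n} {r : ℝ} (hr : 0 < r) {j : ℤ} (hj : 0 < j)
    (hQ : volume (stdCube c r) ≤ 2 * volume (stdCube c r ∩ superlevel F (j - 1)))
    {x y : Rn n} (hx : x ∈ stdCube c (5 * r)) (hy : y ∈ stdCube c r) :
    ‖x - y‖ ≤ (12 * √n + 1) * 2 ^ (-(j * (a / (n + 1)))) := by
  have hxy := norm_sub_le_of_mem_stdCube hx hy
  rcases Nat.eq_zero_or_pos n with rfl | hn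
  · simp only [Subsingleton.elim x y, sub_self, norm_zero]
    positivity
  have hvol : (2 * r) ^ n ≤ 4 * 2 ^ (-(j * a)) := by
    have h1 := hQ.trans (mul_le_mul_right ((measure_mono Set.inter_subset_right).trans
      (volume_superlevel_le ha hap hF hFp (by lia))) 2)
    rw [volume_stdCube _ hr.le, show (2 : ℝ≥0∞) = ENNReal.ofReal 2 by norm_num,
      ← ENNReal.ofReal_mul (by norm_num), ENNReal.ofReal_le_ofReal_iff (by positivity)] at h1
    refine h1.trans ?_
    have h2 : (2 : ℝ) ^ (-(((j - 1 : ℤ) : ℝ) * a)) ≤ 2 ^ (1 + -(j * a)) := by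
      refine Real.rpow_le_rpow_of_exponent_le (by norm_num) ?_
      push_cast
      linarith
    rw [Real.rpow_add (by norm_num), Real.rpow_one] at h2
    linarith
  have hside : 2 * r ≤ 4 * 2 ^ (-(j * (a / (n + 1)))) := by
    refine (pow_le_pow_iff_left₀ (by positivity) (by positivity) hn.ne').1 (hvol.trans ?_)
    rw [mul_pow, ← Real.rpow_natCast (2 ^ _), ← Real.rpow_mul (by norm_num)]
    have hj' : (0 : ℝ) < j := by exact_mod_cast hj
    have h1 : (4 : ℝ) ≤ 4 ^ n := le_self_pow₀ (by norm_num) hn.ne'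
    have h2 : -(j * a) ≤ -(j * (a / (n + 1))) * n := by
      have : a / (n + 1) * n ≤ a := by
        rw [div_mul_eq_mul_div, div_le_iff₀ (by positivity)]
        nlinarith
      nlinarith
    gcongr
    norm_num
  have h0 : (0 : ℝ) < 2 ^ (-(j * (a / (n + 1)))) := by positivity
  calc ‖x - y‖ ≤ √n * (5 * r + r) := hxy
    _ = √n * (3 * (2 * r)) := by ring
    _ ≤ √n * (3 * (4 * 2 ^ (-(j * (a / (n + 1)))))) := by gcongr
    _ ≤ _ := by nlinarith

/-- The modular form of the lemma, for finite sums on the left-hand side. -/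
lemma LogHolder.exists_modular_sum_bound {p : Rn n → ℝ} (hp : LogHolder p) {a b : ℝ} (ha : 0 < a)
    (hb : b < 1) (hpab : ∀ x, a ≤ p x ∧ p x ≤ b) :
    ∃ K : ℝ≥0∞, K ≠ ⊤ ∧ ∀ (Q : ℕ → Set (Rn n)) (f : ℕ → Rn n → ℝ≥0∞),
      (∀ k, IsCube (Q k)) → (∀ k, Measurable (f k)) → (∀ k, ∀ x ∉ Q k, f k x = 0) →
      ∫⁻ x, (∑' k, (∫⁻ y in Q k, f k y) / volume (Q k) *
        (Q k).indicator (fun _ => (1 : ℝ≥0∞)) x) ^ p x ≤ 1 →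
      ∀ N : ℕ, ∫⁻ x, (∑ k ∈ Finset.range N, f k x) ^ p x ≤ K := by
  classical
  have hpm : Measurable p := hp.continuous.measurable
  have hp0 : ∀ x, 0 < p x := fun x => ha.trans_le (hpab x).1
  have hp1 : ∀ x, p x < 1 := fun x => (hpab x).2.trans_lt hb
  have ha1 : a ≤ 1 := (hpab 0).1.trans (hp1 0).le
  obtain ⟨ε, C, hε, hC, hw⟩ := hp.exists_levelWeight_bounds ha hb hpab
    (D := 12 * √n + 1) (by positivity) (δ := a / (n + 1)) (by positivity)
  obtain ⟨H, hH, hsumH⟩ := exists_sum_lintegral_decayErr_le (n := n) hε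
  set S := ∑' j : ℤ, ENNReal.ofReal (2 ^ (-(a * |(j : ℝ)|))) with hS
  have hStop : S ≠ ⊤ := tsum_ofReal_two_rpow_neg_abs_ne_top ha
  set C' := ENNReal.ofReal C with hC'
  have hC'top : C' ≠ ⊤ := ENNReal.ofReal_ne_top
  have hC'0 : C' ≠ 0 := (ENNReal.ofReal_pos.2 (by linarith)).ne'
  set L : ℝ≥0∞ := C' * (2 * 5 ^ n) with hL
  have hLtop : L ≠ ⊤ := by finiteness
  refine ⟨(1 + 2 * C') * (L * (2 * S) + (L + 2) * H), by finiteness, ?_⟩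
  intro Q f hQ hf hfQ hmod N
  choose c r hr hQeq using hQ
  have hQm : ∀ k, MeasurableSet (Q k) := fun k => by
    rw [hQeq]
    exact measurableSet_stdCube _ (hr k).le
  have hQ0 : ∀ k, volume (Q k) ≠ 0 := fun k => by
    rw [hQeq, volume_stdCube _ (hr k).le]
    have := hr k
    exact (ENNReal.ofReal_pos.2 (by positivity)).ne'
  have hQt : ∀ k, volume (Q k) ≠ ⊤ := fun k => by
    rw [hQeq, volume_stdCube _ (hr k).le]
    exact ENNReal.ofReal_ne_top
  set v : ℕ → ℝ≥0∞ := fun k => (∫⁻ y in Q k, f k y) / volume (Q k) with hv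
  set F : Rn n → ℝ≥0∞ := fun x => ∑' k, v k * (Q k).indicator (fun _ => (1 : ℝ≥0∞)) x with hFdef
  have hF : Measurable F := Measurable.tsum fun k =>
    (measurable_const.indicator (hQm k)).const_mul _
  have hvF : ∀ k, ∀ x ∈ Q k, v k ≤ F x := fun k x hx => by
    refine le_trans ?_ (ENNReal.le_tsum k)
    simp [hx]
  have hcrit : ∀ k, ∃ j : ℤ, v k ≠ 0 → volume (Q k) ≤ 2 * volume (Q k \ superlevel F j) ∧
      volume (Q k) ≤ 2 * volume (Q k ∩ superlevel F (j - 1)) := fun k => by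
    by_cases hk : v k = 0
    · exact ⟨0, fun h => absurd hk h⟩
    · obtain ⟨j, hj⟩ := exists_critical_level ha (fun x => (hpab x).1) hF hmod (hQ0 k) (hQt k) hk
        (hvF k)
      exact ⟨j, fun _ => hj⟩
  choose lev hlev using hcrit
  set T := (Finset.range N).filter fun k => v k ≠ 0 with hT
  set J := T.image lev with hJ
  have hae : ∀ᵐ x ∂(volume : Measure (Rn n)),
      ∑ k ∈ Finset.range N, f k x = ∑ j ∈ J, ∑ k ∈ T with lev k = j, f k x := by
    have h0 : ∀ k, v k = 0 → ∀ᵐ x ∂(volume : Measure (Rn n)), f k x = 0 := fun k hk => by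
      have h1 : ∫⁻ y in Q k, f k y = 0 := (ENNReal.div_eq_zero_iff.1 hk).resolve_right (hQt k)
      have h2 := (setLIntegral_eq_zero_iff (hQm k) (hf k)).1 h1
      filter_upwards [h2] with x hx
      by_cases hxQ : x ∈ Q k
      · exact hx hxQ
      · exact hfQ k x hxQ
    have h1 : ∀ᵐ x ∂(volume : Measure (Rn n)), ∀ k, v k = 0 → f k x = 0 :=
      ae_all_iff.2 fun k => by
        by_cases hk : v k = 0
        · filter_upwards [h0 k hk] with x hx _ using hx
        · exact Eventually.of_forall fun x h => absurd h hk
    filter_upwards [h1] with x hx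
    rw [Finset.sum_fiberwise_of_maps_to fun k hk => Finset.mem_image_of_mem lev hk, hT,
      Finset.sum_filter_of_ne]
    exact fun k _ hne hk => hne (hx k hk)
  have hlevel : ∀ j ∈ J, ∫⁻ x, (∑ k ∈ T with lev k = j, f k x) ^ p x ≤
      (1 + 2 * C') * (L * (∫⁻ x in superlevel F (j - 1), ENNReal.ofReal (2 ^ (j * p x))) +
        (L + 2) * ∫⁻ x : Rn n, ENNReal.ofReal (decayErr ε j x)) := by
    intro j _
    set Tj := T.filter fun k => lev k = j with hTj
    have hTj' : ∀ k ∈ Tj, volume (Q k) ≤ 2 * volume (Q k \ superlevel F j) ∧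
        volume (Q k) ≤ 2 * volume (Q k ∩ superlevel F (j - 1)) := fun k hk => by
      obtain ⟨hkT, hkj⟩ := Finset.mem_filter.1 hk
      exact hkj ▸ hlev k (Finset.mem_filter.1 hkT).2
    set w : Rn n → ℝ≥0∞ := fun x => ENNReal.ofReal (levelWeight p ε j x) with hwdef
    have hwm : Measurable w := (measurable_levelWeight hpm ε j).ennreal_ofReal
    have hnear : ∀ k ∈ Tj, ∀ x ∈ stdCube (c k) (5 * r k), ∀ y ∈ stdCube (c k) (r k), 0 < j →
        ‖x - y‖ ≤ (12 * √n + 1) * 2 ^ (-(j * (a / (n + 1)))) := fun k hk x hx y hy hj =>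
      norm_sub_le_of_critical ha ha1 (fun x => (hpab x).1) hF hmod (hr k) hj
        (by rw [← hQeq]; exact (hTj' k hk).2) hx hy
    have hmono : ∀ k, Q k ⊆ stdCube (c k) (5 * r k) := fun k => by
      rw [hQeq]
      exact fun x hx i => (hx i).trans (by linarith [hr k])
    have hfirst := lintegral_rpow_sum_le_setLIntegral Tj hQm hQ0 hQt hf hfQ hwm
      (measurableSet_superlevel hF j) (fun x => ⟨hp0 x, hp1 x⟩) (C := C)
      (τ := 2 ^ (j : ℝ)) (by positivity) (fun x hx => not_lt.1 hx)
      (fun x => ENNReal.sum_le_tsum Tj) (fun k hk => (hTj' k hk).1) (by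
        intro x
        obtain ⟨s, hs, hsw, hsy⟩ := (hw j x).2
        refine ⟨s, hs, ENNReal.ofReal_le_ofReal hsw, fun k hk hx y hy => ?_⟩
        rw [hwdef]
        simp only
        rw [← ENNReal.ofReal_mul (by positivity), ← Real.rpow_neg (by norm_num)]
        refine ENNReal.ofReal_le_ofReal (hsy y (hnear k hk x (hmono k hx) y ?_))
        rwa [← hQeq])
    have hsecond := setLIntegral_biUnion_stdCube_le Tj c r hr
      (measurableSet_superlevel hF (j - 1)) (fun k hk => by
        rw [← hQeq]
        exact (hTj' k hk).2) (w := w) (e := fun x => 2 * ENNReal.ofReal (decayErr ε j x))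
      ((measurable_decayErr ε j).ennreal_ofReal.const_mul 2) hC'0 hC'top (by
        intro k hk x hx y hy
        refine (ENNReal.ofReal_le_ofReal ((hw j x).1 y (hnear k hk x hx y hy))).trans ?_
        refine ENNReal.ofReal_add_le.trans_eq ?_
        rw [ENNReal.ofReal_mul (by positivity), ENNReal.ofReal_mul (by norm_num),
          ENNReal.ofReal_ofNat])
    simp_rw [← hQeq] at hsecond
    rw [lintegral_const_mul _ (measurable_decayErr ε j).ennreal_ofReal] at hsecond
    have hthird : ∫⁻ x in superlevel F (j - 1), w x ≤
        (∫⁻ x in superlevel F (j - 1), ENNReal.ofReal (2 ^ (j * p x))) +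
          ∫⁻ x : Rn n, ENNReal.ofReal (decayErr ε j x) := by
      refine (lintegral_mono fun x => ENNReal.ofReal_add_le).trans ?_
      rw [lintegral_add_right _ (measurable_decayErr ε j).ennreal_ofReal]
      exact add_le_add_right (setLIntegral_le_lintegral _ _) _
    refine hfirst.trans (mul_le_mul_right (hsecond.trans ?_) _)
    refine (add_le_add_left (mul_le_mul_right hthird _) _).trans_eq ?_
    rw [hL]
    ring
  have hmain : ∑ j ∈ J, ∫⁻ x in superlevel F (j - 1), ENNReal.ofReal (2 ^ (j * p x)) ≤ 2 * S := by
    calc ∑ j ∈ J, ∫⁻ x in superlevel F (j - 1), ENNReal.ofReal (2 ^ (j * p x))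
        = ∫⁻ x, ∑ j ∈ J with x ∈ superlevel F (j - 1), ENNReal.ofReal (2 ^ (j * p x)) := by
          simp_rw [Finset.sum_filter]
          rw [lintegral_finsetSum]
          · refine Finset.sum_congr rfl fun j _ => ?_
            rw [← lintegral_indicator (measurableSet_superlevel hF _)]
            rfl
          · intro j _
            exact Measurable.ite (measurableSet_superlevel hF _) (by fun_prop) measurable_const
      _ ≤ ∫⁻ x, 2 * S * F x ^ p x := lintegral_mono fun x =>
          sum_two_rpow_mul_le _ ha (hpab x).1 (hp1 x).le fun j hj => (Finset.mem_filter.1 hj).2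
      _ ≤ 2 * S := by
          rw [lintegral_const_mul' _ _ (by finiteness)]
          exact mul_le_of_le_one_right' hmod
  calc ∫⁻ x, (∑ k ∈ Finset.range N, f k x) ^ p x
      = ∫⁻ x, (∑ j ∈ J, ∑ k ∈ T with lev k = j, f k x) ^ p x :=
        lintegral_congr_ae (hae.mono fun x hx => by simp only [hx])
    _ ≤ ∫⁻ x, ∑ j ∈ J, (∑ k ∈ T with lev k = j, f k x) ^ p x :=
        lintegral_mono fun x => ENNReal.rpow_finsetSum_le _ _ (hp0 x) (hp1 x).le
    _ = ∑ j ∈ J, ∫⁻ x, (∑ k ∈ T with lev k = j, f k x) ^ p x :=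
        lintegral_finsetSum _ fun j _ =>
          (Finset.measurable_fun_sum _ fun k _ => hf k).pow hpm
    _ ≤ ∑ j ∈ J, (1 + 2 * C') * (L * (∫⁻ x in superlevel F (j - 1),
          ENNReal.ofReal (2 ^ (j * p x))) +
          (L + 2) * ∫⁻ x : Rn n, ENNReal.ofReal (decayErr ε j x)) := Finset.sum_le_sum hlevel
    _ ≤ _ := by
        rw [← Finset.mul_sum, Finset.sum_add_distrib, ← Finset.mul_sum, ← Finset.mul_sum]
        gcongr
        exact hsumH J

/-- The modular form of the lemma. -/
lemma LogHolder.exists_modular_tsum_bound {p : Rn n → ℝ} (hp : LogHolder p) {a b : ℝ} (ha : 0 < a)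
    (hb : b < 1) (hpab : ∀ x, a ≤ p x ∧ p x ≤ b) :
    ∃ K : ℝ≥0∞, K ≠ ⊤ ∧ ∀ (Q : ℕ → Set (Rn n)) (f : ℕ → Rn n → ℝ≥0∞),
      (∀ k, IsCube (Q k)) → (∀ k, Measurable (f k)) → (∀ k, ∀ x ∉ Q k, f k x = 0) →
      ∫⁻ x, (∑' k, (∫⁻ y in Q k, f k y) / volume (Q k) *
        (Q k).indicator (fun _ => (1 : ℝ≥0∞)) x) ^ p x ≤ 1 →
      ∫⁻ x, (∑' k, f k x) ^ p x ≤ K := by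
  obtain ⟨K, hK, h⟩ := hp.exists_modular_sum_bound ha hb hpab
  refine ⟨K, hK, fun Q f hQ hf hfQ hmod => ?_⟩
  have hpm : Measurable p := hp.continuous.measurable
  have hp0 : ∀ x, 0 < p x := fun x => ha.trans_le (hpab x).1
  have hmono : ∀ x, Monotone fun N => ∑ k ∈ Finset.range N, f k x := fun x M N hMN =>
    Finset.sum_le_sum_of_subset (Finset.range_mono hMN)
  have hsup : ∀ x, (∑' k, f k x) ^ p x = ⨆ N, (∑ k ∈ Finset.range N, f k x) ^ p x := fun x => by
    rw [ENNReal.tsum_eq_iSup_nat]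
    exact (ENNReal.orderIsoRpow (p x) (hp0 x)).map_iSup _
  simp_rw [hsup]
  rw [lintegral_iSup]
  · exact iSup_le (h Q f hQ hf hfQ hmod)
  · exact fun N => (Finset.measurable_fun_sum _ fun k _ => hf k).pow hpm
  · exact fun M N hMN x => ENNReal.rpow_le_rpow (hmono x hMN) (hp0 x).le

/-- (Variable-exponent Grafakos–Kalton lemma.)  Let `p(·) ∈ 𝒫₀` with
`0 < p_- ≤ p_+ < 1` and `p(·) ∈ LH`.  Then for all cubes `{Q_k}` and nonnegative `g_k`
supported in `Q_k`, `‖∑ g_k‖_{L^{p(·)}} ≲ ‖∑ (⨍_{Q_k} g_k) χ_{Q_k}‖_{L^{p(·)}}`. -/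
theorem stmt12_variable_grafakos_kalton (n : ℕ) (pv : Rn n → ℝ)
    (hpv : ExponentP0 pv) (hLH : LogHolder pv)
    (hpm : 0 < essInf pv (volume : Measure (Rn n)))
    (hpb : ∃ B : ℝ, ∀ᵐ x ∂(volume : Measure (Rn n)), pv x ≤ B)
    (hpp : essSup pv (volume : Measure (Rn n)) < 1) :
    ∃ C : ℝ, 0 < C ∧ ∀ (Q : ℕ → Set (Rn n)) (g : ℕ → Rn n → ℝ),
      (∀ k, IsCube (Q k)) →
      (∀ k, Measurable (g k) ∧ (∀ x, 0 ≤ g k x) ∧ Function.support (g k) ⊆ Q k) →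
      varLpE pv (fun x => ∑' k, ENNReal.ofReal (g k x)) ≤
        ENNReal.ofReal C * varLpE pv
          (fun x => ∑' k, cubeAvgE (Q k) (g k) * (Q k).indicator (fun _ => (1 : ℝ≥0∞)) x) := by
  have hcont := hLH.continuous
  have hbdd : IsBoundedUnder (· ≥ ·) (ae (volume : Measure (Rn n))) pv :=
    ⟨0, eventually_map.2 (Eventually.of_forall fun x => (hpv.2 x).le)⟩
  obtain ⟨B, hB⟩ := hpb
  have hlow := forall_of_ae_mem_closed hcont isClosed_Ici (ae_essInf_le hbdd)
  have hup := forall_of_ae_mem_closed hcont isClosed_Iic (ae_le_essSup ⟨B, eventually_map.2 hB⟩)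
  set a := essInf pv (volume : Measure (Rn n))
  obtain ⟨K, hK, h⟩ := hLH.exists_modular_tsum_bound hpm hpp fun x => ⟨hlow x, hup x⟩
  set M : ℝ := max 1 K.toReal with hM
  have hM1 : 1 ≤ M := le_max_left _ _
  set C : ℝ := M ^ (1 / a) with hCdef
  have hC : 0 < C := by positivity
  have hC' : ENNReal.ofReal C ≠ 0 := (ENNReal.ofReal_pos.2 hC).ne'
  refine ⟨C, hC, fun Q g hQ hg => ?_⟩
  rw [varLpE, varLpE, sInf_eq_iInf', sInf_eq_iInf',
    ENNReal.mul_iInf_of_ne hC' ENNReal.ofReal_ne_top]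
  refine le_iInf fun ⟨lam, hlam, hmod⟩ => ?_
  simp only
  rcases eq_or_ne lam ⊤ with rfl | hlt
  · rw [ENNReal.mul_top hC']
    exact le_top
  have hkey := h Q (fun k x => ENNReal.ofReal (g k x) / lam) hQ
    (fun k => (hg k).1.ennreal_ofReal.div_const _) (fun k x hx => by
      have : g k x = 0 := Function.notMem_support.1 fun hs => hx ((hg k).2.2 hs)
      simp [this]) (by
      refine le_of_eq_of_le (lintegral_congr fun x => ?_) hmod
      congr 1
      simp_rw [div_eq_mul_inv]
      rw [← ENNReal.tsum_mul_right]
      refine tsum_congr fun k => ?_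
      rw [lintegral_mul_const _ (hg k).1.ennreal_ofReal, cubeAvgE, div_eq_mul_inv]
      ring)
  refine iInf_le_of_le ⟨ENNReal.ofReal C * lam, ?_, ?_⟩ le_rfl
  · exact pos_iff_ne_zero.2 (mul_ne_zero hC' hlam.ne')
  calc ∫⁻ x, ((∑' k, ENNReal.ofReal (g k x)) / (ENNReal.ofReal C * lam)) ^ pv x
      ≤ ∫⁻ x, (ENNReal.ofReal M)⁻¹ * (∑' k, ENNReal.ofReal (g k x) / lam) ^ pv x := by
        refine lintegral_mono fun x => ?_
        have h1 : (∑' k, ENNReal.ofReal (g k x)) / (ENNReal.ofReal C * lam) =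
            (ENNReal.ofReal C)⁻¹ * ∑' k, ENNReal.ofReal (g k x) / lam := by
          simp_rw [div_eq_mul_inv]
          rw [ENNReal.tsum_mul_right, ENNReal.mul_inv (Or.inl hC') (Or.inl ENNReal.ofReal_ne_top)]
          ring
        rw [h1, ENNReal.mul_rpow_of_nonneg _ _ (hpv.2 x).le]
        gcongr
        rw [ENNReal.inv_rpow, ENNReal.inv_le_inv, ENNReal.ofReal_rpow_of_pos hC, hCdef,
          ← Real.rpow_mul (by positivity)]
        refine ENNReal.ofReal_le_ofReal (Real.self_le_rpow_of_one_le hM1 ?_)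
        rw [one_div_mul_eq_div, one_le_div hpm]
        exact hlow x
    _ = (ENNReal.ofReal M)⁻¹ * ∫⁻ x, (∑' k, ENNReal.ofReal (g k x) / lam) ^ pv x :=
        lintegral_const_mul' _ _ (ENNReal.inv_ne_top.2 (ENNReal.ofReal_pos.2 (by positivity)).ne')
    _ ≤ (ENNReal.ofReal M)⁻¹ * ENNReal.ofReal M := by
        gcongr
        refine hkey.trans ?_
        rw [← ENNReal.ofReal_toReal hK]
        exact ENNReal.ofReal_le_ofReal (le_max_right _ _)
    _ ≤ 1 := ENNReal.inv_mul_le_one _
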